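/- arXiv:2104.06175 — 2 statements merged into one kernel-verified Lean document; each statement's English description precedes it below -/
import Mathlib

section
/- For every dimension d ≥ 1 and every vector of correlative angles φ ∈ [0,π]^{d(d-1)/2}, the matrix C' = B(φ) · B(φ)ᵀ is a valid correlation matrix: it is symmetric, positive semidefinite, has all diagonal entries equal to 1, and all of its entries lie in [-1, 1]. -/
open Matrix Real

/-- The elementary hypersphere matrix `B(φ)` (0-based indexing): row `i`, column `j` entries are
`b_{00} = 1`; `b_{i0} = cos φ_{i0}` for `i > 0`; `b_{ij} = cos φ_{ij} ∏_{k<j} sin φ_{ik}` for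
`0 < j < i`; `b_{ii} = ∏_{k<i} sin φ_{ik}` for `i > 0`; and `b_{ij} = 0` for `j > i`. -/
noncomputable def hsB (d : ℕ) (φ : ℕ → ℕ → ℝ) : Matrix (Fin d) (Fin d) ℝ :=
  fun i j =>
    if (j : ℕ) < (i : ℕ) then
      Real.cos (φ i j) * ∏ k ∈ Finset.range j, Real.sin (φ i k)
    else if (j : ℕ) = (i : ℕ) then
      ∏ k ∈ Finset.range i, Real.sin (φ i k)
    else 0

/-- The spherical coordinates of a point of the unit sphere have squares summing to one. -/
theorem sum_sq_cos_mul_prod_sin_add_sq_prod_sin (θ : ℕ → ℝ) (n : ℕ) :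
    ∑ j ∈ Finset.range n, (Real.cos (θ j) * ∏ k ∈ Finset.range j, Real.sin (θ k)) ^ 2 +
      (∏ k ∈ Finset.range n, Real.sin (θ k)) ^ 2 = 1 := by
  induction n with
  | zero => simp
  | succ n ih =>
    rw [Finset.sum_range_succ, Finset.prod_range_succ]
    linear_combination ih +
      (∏ k ∈ Finset.range n, Real.sin (θ k)) ^ 2 * Real.sin_sq_add_cos_sq (θ n)

/-- Every row of the hypersphere matrix is a unit vector. -/
theorem sum_hsB_sq (d : ℕ) (φ : ℕ → ℕ → ℝ) (i : Fin d) : ∑ j, hsB d φ i j ^ 2 = 1 := by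
  rw [← sum_sq_cos_mul_prod_sin_add_sq_prod_sin (φ i) i]
  simp only [hsB]
  rw [Fin.sum_univ_eq_sum_range (fun j : ℕ => (if j < (i : ℕ) then
      Real.cos (φ i j) * ∏ k ∈ Finset.range j, Real.sin (φ i k)
    else if j = (i : ℕ) then ∏ k ∈ Finset.range i, Real.sin (φ i k) else 0) ^ 2) d,
    ← Finset.sum_subset (Finset.range_mono (Nat.succ_le_of_lt i.isLt)),
    Nat.succ_eq_add_one, Finset.sum_range_succ]
  · congr 1
    · exact Finset.sum_congr rfl fun j hj => by rw [if_pos (Finset.mem_range.mp hj)]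
    · simp
  · intro j _ hj
    rw [Finset.mem_range] at hj
    rw [if_neg (by lia), if_neg (by lia)]
    simp

/-- The Gram matrix of unit rows has entries in `[-1, 1]`, by Cauchy–Schwarz. -/
theorem mul_transpose_apply_mem_Icc {m n : Type*} [Fintype n] (A : Matrix m n ℝ)
    (hA : ∀ i, ∑ j, A i j ^ 2 = 1) (i j : m) : (A * Aᵀ) i j ∈ Set.Icc (-1 : ℝ) 1 := by
  have h := Finset.sum_mul_sq_le_sq_mul_sq Finset.univ (A i) (A j)
  rw [hA, hA, mul_one] at h
  exact abs_le.mp ((sq_le_one_iff_abs_le_one _).mp h)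

/-- `C' = B(φ) · B(φ)ᵀ` is a valid correlation matrix: symmetric, positive semidefinite,
unit diagonal, and all entries in `[-1, 1]`. -/
theorem hsB_mul_transpose_valid_correlation (d : ℕ) (hd : 1 ≤ d) (φ : ℕ → ℕ → ℝ)
    (hφ : ∀ i j : ℕ, j < i → i < d → φ i j ∈ Set.Icc 0 Real.pi) :
    (hsB d φ * (hsB d φ)ᵀ).IsSymm ∧
    (∀ x : Fin d → ℝ, 0 ≤ x ⬝ᵥ (hsB d φ * (hsB d φ)ᵀ).mulVec x) ∧
    (∀ i : Fin d, (hsB d φ * (hsB d φ)ᵀ) i i = 1) ∧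
    (∀ i j : Fin d, (hsB d φ * (hsB d φ)ᵀ) i j ∈ Set.Icc (-1 : ℝ) 1) := by
  refine ⟨Matrix.isSymm_mul_transpose_self _, fun x => ?_, fun i => ?_,
    mul_transpose_apply_mem_Icc _ (sum_hsB_sq d φ)⟩
  · rw [← Matrix.mulVec_mulVec, Matrix.dotProduct_mulVec, ← Matrix.mulVec_transpose]
    exact Finset.sum_nonneg fun k _ => mul_self_nonneg _
  · rw [Matrix.mul_apply, ← sum_hsB_sq d φ i]
    exact Finset.sum_congr rfl fun k _ => (sq _).symm
end

section
/- The hypersphere decomposition parameterizes all correlation matrices: for every dimension d ≥ 1 and every d×d real matrix C that is symmetric, positive semidefinite, and has all diagonal entries equal to 1, there exists a vector of correlative angles φ ∈ [0,π]^{d(d-1)/2} such that C = B(φ) · B(φ)ᵀ. -/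
open Matrix Real

/-- Polar coordinates of a point `(x, y)` of the closed upper half-plane. -/
theorem exists_polar_angle (x y : ℝ) (hy : 0 ≤ y) :
    ∃ θ ∈ Set.Icc 0 π, x = √(x ^ 2 + y ^ 2) * cos θ ∧ y = √(x ^ 2 + y ^ 2) * sin θ := by
  have h : ‖(⟨x, y⟩ : ℂ)‖ = √(x ^ 2 + y ^ 2) := by
    rw [Complex.norm_eq_sqrt_sq_add_sq]
  refine ⟨Complex.arg ⟨x, y⟩, ⟨Complex.arg_nonneg_iff.2 hy, Complex.arg_le_pi _⟩, ?_, ?_⟩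
  · rw [← h, Complex.norm_mul_cos_arg]
  · rw [← h, Complex.norm_mul_sin_arg]

/-- Hyperspherical coordinates of a point of `ℝ^{n+1}` with nonnegative last coordinate. -/
theorem exists_hyperspherical_angles (n : ℕ) (x : ℕ → ℝ) (hx : 0 ≤ x n) :
    ∃ θ : ℕ → ℝ, (∀ k, θ k ∈ Set.Icc 0 π) ∧
      (∀ j < n, x j = √(∑ k ∈ Finset.range (n + 1), x k ^ 2) *
        (cos (θ j) * ∏ k ∈ Finset.range j, sin (θ k))) ∧
      x n = √(∑ k ∈ Finset.range (n + 1), x k ^ 2) * ∏ k ∈ Finset.range n, sin (θ k) := by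
  induction n generalizing x with
  | zero => exact ⟨fun _ => 0, fun _ => ⟨le_rfl, pi_pos.le⟩, by simp, by simp [sqrt_sq hx]⟩
  | succ n ih =>
    obtain ⟨θ, hθ, hlt, hlast⟩ := ih (fun k => x (k + 1)) hx
    set r := √(∑ k ∈ Finset.range (n + 1), x (k + 1) ^ 2) with hr
    obtain ⟨α, hα, hcos, hsin⟩ := exists_polar_angle (x 0) r (sqrt_nonneg _)
    have hsum : x 0 ^ 2 + r ^ 2 = ∑ k ∈ Finset.range (n + 1 + 1), x k ^ 2 := by
      rw [Finset.sum_range_succ', hr, sq_sqrt (Finset.sum_nonneg fun _ _ => sq_nonneg _), add_comm]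
    rw [hsum] at hcos hsin
    refine ⟨fun | 0 => α | k + 1 => θ k, ?_, ?_, ?_⟩
    · rintro (_ | k)
      exacts [hα, hθ k]
    · rintro (_ | j) hj
      · simpa using hcos
      · rw [hlt j (by omega), hsin, Finset.prod_range_succ']
        dsimp only
        ring
    · rw [hlast, hsin, Finset.prod_range_succ']
      dsimp only
      ring

/-- Cholesky factorization of a real positive semidefinite matrix. -/
theorem Matrix.PosSemidef.exists_cholesky {d : ℕ} {C : Matrix (Fin d) (Fin d) ℝ}
    (hC : C.PosSemidef) :
    ∃ L : Matrix (Fin d) (Fin d) ℝ,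
      (∀ i j, i < j → L i j = 0) ∧ (∀ i, 0 ≤ L i i) ∧ C = L * Lᵀ := by
  obtain ⟨A, hA⟩ : ∃ A : Matrix (Fin d) (Fin d) ℝ, C = Aᴴ * A := by
    open scoped MatrixOrder in
    exact CStarAlgebra.nonneg_iff_eq_star_mul_self.1 hC.nonneg
  let f : Fin d → EuclideanSpace ℝ (Fin d) := fun i => WithLp.toLp 2 (A.col i)
  have hf : ∀ i j, C i j = inner ℝ (f i) (f j) := fun i j => by
    simp [hA, Matrix.mul_apply, f, PiLp.inner_apply, mul_comm]
  let b := InnerProductSpace.gramSchmidtOrthonormalBasis (𝕜 := ℝ)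
    (finrank_euclideanSpace_fin.trans (Fintype.card_fin d).symm) f
  let s : Fin d → ℝ := fun j => if 0 ≤ inner ℝ (f j) (b j) then 1 else -1
  have hs : ∀ j, s j * s j = 1 := fun j => by
    simp only [s]; split_ifs <;> norm_num
  refine ⟨Matrix.of fun i j => s j * inner ℝ (f i) (b j), fun i j hij => ?_, fun i => ?_, ?_⟩
  · rw [Matrix.of_apply, real_inner_comm,
      InnerProductSpace.gramSchmidtOrthonormalBasis_inv_triangular _ f hij, mul_zero]
  · simp only [Matrix.of_apply, s]
    split_ifs <;> linarith
  · ext i j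
    rw [hf, ← b.sum_inner_mul_inner, Matrix.mul_apply]
    refine Finset.sum_congr rfl fun k _ => ?_
    rw [Matrix.transpose_apply, Matrix.of_apply, Matrix.of_apply, real_inner_comm (f j) (b k)]
    linear_combination (-inner ℝ (f i) (b k) * inner ℝ (f j) (b k)) * hs k

/-- A lower triangular matrix with nonnegative diagonal and unit rows is a hypersphere matrix. -/
theorem exists_hsB_of_lowerTriangular {d : ℕ} (L : Matrix (Fin d) (Fin d) ℝ)
    (htri : ∀ i j, i < j → L i j = 0) (hnonneg : ∀ i, 0 ≤ L i i)
    (hunit : ∀ i, ∑ j, L i j ^ 2 = 1) :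
    ∃ φ : ℕ → ℕ → ℝ, (∀ i j, φ i j ∈ Set.Icc 0 π) ∧ L = hsB d φ := by
  let x : ℕ → ℕ → ℝ := fun i j => if h : i < d ∧ j < d then L ⟨i, h.1⟩ ⟨j, h.2⟩ else 0
  have hx : ∀ i j : Fin d, x i j = L i j := fun i j => by simp [x]
  have hdiag : ∀ i, 0 ≤ x i i := fun i => by
    simp only [x]; split_ifs
    exacts [hnonneg _, le_rfl]
  choose φ hφ hlt hlast using fun i => exists_hyperspherical_angles i (x i) (hdiag i)
  have hrow : ∀ i : Fin d, ∑ k ∈ Finset.range ((i : ℕ) + 1), x i k ^ 2 = 1 := fun i => by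
    rw [← hunit i]
    simp_rw [← hx i]
    rw [Fin.sum_univ_eq_sum_range (fun k => x i k ^ 2) d]
    refine Finset.sum_subset (Finset.range_subset_range.2 i.2) fun k hk hki => ?_
    have hkd : k < d := Finset.mem_range.1 hk
    have hik : i < ⟨k, hkd⟩ := by
      rw [Finset.mem_range] at hki
      exact Fin.lt_def.2 (by simp only; omega)
    rw [hx i ⟨k, hkd⟩, htri i _ hik, sq, mul_zero]
  refine ⟨φ, hφ, ?_⟩
  ext i j
  rw [hsB]
  split_ifs with h h'
  · rw [← hx, hlt i j h, hrow, sqrt_one, one_mul]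
  · rw [← hx, h', hlast i, hrow, sqrt_one, one_mul]
  · exact htri i j (Fin.lt_def.2 (by omega))

/-- The hypersphere decomposition parameterizes all correlation matrices: every symmetric
positive semidefinite matrix with unit diagonal is of the form `B(φ) · B(φ)ᵀ` for some
correlative angles `φ ∈ [0, π]^{d(d-1)/2}`. -/
theorem exists_hsB_of_correlation (d : ℕ) (hd : 1 ≤ d) (C : Matrix (Fin d) (Fin d) ℝ)
    (hsymm : C.IsSymm) (hpsd : ∀ x : Fin d → ℝ, 0 ≤ x ⬝ᵥ C.mulVec x)
    (hdiag : ∀ i : Fin d, C i i = 1) :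
    ∃ φ : ℕ → ℕ → ℝ, (∀ i j : ℕ, j < i → i < d → φ i j ∈ Set.Icc 0 Real.pi) ∧
      C = hsB d φ * (hsB d φ)ᵀ := by
  have hC : C.PosSemidef := .of_dotProduct_mulVec_nonneg hsymm hpsd
  obtain ⟨L, htri, hnonneg, hL⟩ := hC.exists_cholesky
  have hunit : ∀ i, ∑ j, L i j ^ 2 = 1 := fun i => by
    rw [← hdiag i, hL, Matrix.mul_apply]
    simp [sq]
  obtain ⟨φ, hφ, rfl⟩ := exists_hsB_of_lowerTriangular L htri hnonneg hunit
  exact ⟨φ, fun i j _ _ => hφ i j, hL⟩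
end
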